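/- Let p be an odd prime, t ≥ 1, m = p^t, and ζ = exp(2πi/m) ∈ ℂ. Let k be an integer and let c, d be integers not divisible by p. If (−4kζ)/(ζ − 1)^2 + p · ((ζ^c + 1)/(ζ^c − 1)) · ((ζ^d + 1)/(ζ^d − 1)) = p, then k = p, and either c ≡ 1 and d ≡ 1 (mod p^t), or c ≡ −1 and d ≡ −1 (mod p^t). -/

import Mathlib

theorem Int.dvd_of_eq_mul_isIntegral {a b : ℤ} {z : ℂ} (hz : IsIntegral ℤ z)
    (h : (a : ℂ) = b * z) : b ∣ a := by
  rcases eq_or_ne b 0 with rfl | hb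
  · have : (a : ℂ) = 0 := by simpa using h
    simpa using this
  have hbC : (b : ℂ) ≠ 0 := by exact_mod_cast hb
  have hzq : z = algebraMap ℚ ℂ ((a : ℚ) / b) := by
    simp only [map_div₀, map_intCast, h]
    field_simp
  rw [hzq, isIntegral_algebraMap_iff (algebraMap ℚ ℂ).injective] at hz
  obtain ⟨n, hn⟩ := IsIntegrallyClosed.isIntegral_iff.mp hz
  have hbQ : (b : ℚ) ≠ 0 := by exact_mod_cast hb
  refine ⟨n, ?_⟩
  rw [eq_div_iff hbQ] at hn
  have : (n : ℚ) * b = a := by simpa using hn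
  rw [mul_comm]
  exact_mod_cast this.symm

theorem isIntegral_zpow_of_pow_eq_one {x : ℂ} {m : ℕ} (hm : 0 < m) (hx : x ^ m = 1) (n : ℤ) :
    IsIntegral ℤ (x ^ n) := by
  refine IsIntegral.of_pow hm ?_
  rw [← zpow_natCast, zpow_comm, zpow_natCast, hx, one_zpow]
  exact isIntegral_one

theorem exists_isIntegral_zpow_sub_one_eq_mul {x : ℂ} {m : ℕ} (hm : 0 < m) (hx : x ^ m = 1)
    (n : ℤ) : ∃ z, IsIntegral ℤ z ∧ x ^ n - 1 = (x - 1) * z := by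
  have hx0 : x ≠ 0 := by rintro rfl; simp [hm.ne'] at hx
  have hzint : IsIntegral ℤ x := by simpa using isIntegral_zpow_of_pow_eq_one hm hx 1
  have hmZ : (m : ℤ) ≠ 0 := by exact_mod_cast hm.ne'
  have key : x ^ n = x ^ (n % m).toNat := by
    rw [← zpow_natCast, Int.toNat_of_nonneg (Int.emod_nonneg _ hmZ)]
    conv_lhs => rw [← Int.emod_add_mul_ediv n m, zpow_add₀ hx0, zpow_mul, zpow_natCast, hx,
      one_zpow, mul_one]
  refine ⟨∑ i ∈ Finset.range (n % m).toNat, x ^ i, IsIntegral.sum _ fun i _ => hzint.pow i, ?_⟩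
  rw [key, mul_geom_sum]

theorem exists_isIntegral_sub_one_eq_zpow_sub_one_mul {x : ℂ} {m : ℕ} (hm : 0 < m)
    (hx : x ^ m = 1) {n : ℤ} (hn : IsCoprime n m) :
    ∃ z, IsIntegral ℤ z ∧ x - 1 = (x ^ n - 1) * z := by
  have hx0 : x ≠ 0 := by rintro rfl; simp [hm.ne'] at hx
  obtain ⟨a, b, hab⟩ := hn
  have hpow : (x ^ n) ^ m = 1 := by
    rw [← zpow_natCast, zpow_comm, zpow_natCast, hx, one_zpow]
  obtain ⟨z, hz, h⟩ := exists_isIntegral_zpow_sub_one_eq_mul hm hpow a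
  refine ⟨z, hz, ?_⟩
  rw [← h, ← zpow_mul]
  have : n * a = 1 + m * (-b) := by linarith
  rw [this, zpow_add₀ hx0, zpow_mul, zpow_natCast, hx, one_zpow, zpow_one, mul_one]

theorem exists_isIntegral_add_one_mul_eq_one {x : ℂ} {m : ℕ} (hm : Odd m) (hx : x ^ m = 1)
    (hx1 : x ≠ 1) : ∃ z, IsIntegral ℤ z ∧ (x + 1) * z = 1 := by
  have hcop : IsCoprime (2 : ℤ) m := by
    have := Nat.isCoprime_iff_coprime.mpr (Nat.coprime_two_left.mpr hm)
    exact_mod_cast this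
  obtain ⟨z, hz, h⟩ := exists_isIntegral_sub_one_eq_zpow_sub_one_mul hm.pos hx hcop
  refine ⟨z, hz, mul_left_cancel₀ (sub_ne_zero.mpr hx1) ?_⟩
  rw [show (2 : ℤ) = (2 : ℕ) by rfl, zpow_natCast] at h
  linear_combination -h

theorem Complex.eq_one_of_mul_sub_one_sq_add_eq_zero {z w : ℂ} (hz : ‖z‖ = 1) (hw : ‖w‖ = 1)
    (h : z * (w - 1) ^ 2 + w * (z - 1) ^ 2 = 0) : z = 1 := by
  have conj_mul {u : ℂ} (hu : ‖u‖ = 1) : u * (starRingEnd ℂ) u = 1 := by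
    rw [Complex.mul_conj, Complex.normSq_eq_norm_sq, hu]; norm_num
  have hzc := conj_mul hz
  have hwc := conj_mul hw
  have hsum : w + (starRingEnd ℂ) w + (z + (starRingEnd ℂ) z) = 4 := by
    have hzw : z * w ≠ 0 := by
      rw [← norm_pos_iff, norm_mul, hz, hw]; norm_num
    refine mul_left_cancel₀ hzw ?_
    linear_combination h + z * hwc + w * hzc
  have hre : w.re + z.re = 2 := by
    have := congrArg Complex.re hsum
    simp at this
    linarith
  have h1 := Complex.re_le_norm z
  have h2 := Complex.re_le_norm w
  have hzre : z.re = 1 := by linarith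
  have hns : z.re * z.re + z.im * z.im = 1 := by
    rw [← Complex.normSq_apply, Complex.normSq_eq_norm_sq, hz]; norm_num
  apply Complex.ext
  · simpa using hzre
  · have : z.im * z.im = 0 := by rw [hzre] at hns; linarith
    simpa using this

theorem IsPrimitiveRoot.zpow_eq_zpow_iff_modEq {x : ℂ} {m : ℕ} (hx : IsPrimitiveRoot x m)
    (hm : 0 < m) (a b : ℤ) : x ^ a = x ^ b ↔ a ≡ b [ZMOD m] := by
  have hx0 : x ≠ 0 := hx.ne_zero hm.ne'
  rw [Int.modEq_comm, Int.modEq_iff_dvd, ← hx.zpow_eq_one_iff_dvd, zpow_sub₀ hx0,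
    div_eq_one_iff_eq (zpow_ne_zero _ hx0)]

theorem stmt_6 (p t : ℕ) (hp : p.Prime) (hodd : Odd p) (ht : 1 ≤ t)
    (m : ℕ) (hm : m = p ^ t)
    (ζ : ℂ) (hζ : ζ = Complex.exp (2 * Real.pi * Complex.I / m))
    (k c d : ℤ) (hc : ¬ (p : ℤ) ∣ c) (hd : ¬ (p : ℤ) ∣ d)
    (h : (-4 * (k : ℂ) * ζ) / (ζ - 1) ^ 2 +
         (p : ℂ) * ((ζ ^ c + 1) / (ζ ^ c - 1)) * ((ζ ^ d + 1) / (ζ ^ d - 1)) = (p : ℂ)) :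
    k = (p : ℤ) ∧
      ((c ≡ 1 [ZMOD (m : ℤ)] ∧ d ≡ 1 [ZMOD (m : ℤ)]) ∨
       (c ≡ -1 [ZMOD (m : ℤ)] ∧ d ≡ -1 [ZMOD (m : ℤ)])) := by
  have hm0 : 0 < m := hm ▸ pow_pos hp.pos t
  have hmodd : Odd m := hm ▸ hodd.pow
  have hpm : (p : ℤ) ∣ m := by
    rw [hm]; exact_mod_cast dvd_pow_self p (by omega)
  have hprim : IsPrimitiveRoot ζ m := hζ ▸ Complex.isPrimitiveRoot_exp m hm0.ne'
  have hζm : ζ ^ m = 1 := hprim.pow_eq_one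
  have hζ0 : ζ ≠ 0 := hprim.ne_zero hm0.ne'
  have hpowm (n : ℤ) : (ζ ^ n) ^ m = 1 := by
    rw [← zpow_natCast, zpow_comm, zpow_natCast, hζm, one_zpow]
  have hne {n : ℤ} (hn : ¬ (p : ℤ) ∣ n) : ζ ^ n - 1 ≠ 0 := by
    rw [sub_ne_zero, Ne, hprim.zpow_eq_one_iff_dvd]
    exact fun h' => hn (hpm.trans h')
  have hζ1 : ζ - 1 ≠ 0 := by
    have h1 : ¬ (p : ℤ) ∣ 1 := by
      exact_mod_cast fun h' => hp.one_lt.ne' (Nat.dvd_one.mp h')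
    simpa using hne h1
  have hcop : IsCoprime c m := by
    rw [hm, Nat.cast_pow]
    exact (((Nat.prime_iff_prime_int.mp hp).coprime_iff_not_dvd).mpr hc).symm.pow_right
  have hcne := hne hc
  have hdne := hne hd
  have hmain : 2 * k * ζ * ((ζ ^ c - 1) * (ζ ^ d - 1)) =
      p * (ζ - 1) ^ 2 * (ζ ^ c + ζ ^ d) := by
    field_simp at h
    linear_combination -h / 2
  obtain ⟨u, hu, hcu⟩ := exists_isIntegral_zpow_sub_one_eq_mul hm0 hζm c
  obtain ⟨v, hv, hdv⟩ := exists_isIntegral_zpow_sub_one_eq_mul hm0 hζm d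
  have hzint (n : ℤ) := isIntegral_zpow_of_pow_eq_one hm0 hζm n
  have hζint : IsIntegral ℤ ζ := by simpa using hzint 1
  have hred : 2 * k * ζ * (u * v) = p * (ζ ^ c + ζ ^ d) := by
    refine mul_left_cancel₀ (pow_ne_zero 2 hζ1) ?_
    rw [hcu, hdv] at hmain
    linear_combination hmain
  have hcd : ζ ^ c = ζ ^ d := by
    by_contra hcd
    have hcd1 : ζ ^ (c - d) ≠ 1 := by
      rwa [zpow_sub₀ hζ0, Ne, div_eq_one_iff_eq (zpow_ne_zero _ hζ0)]
    obtain ⟨z, hz, hz1⟩ := exists_isIntegral_add_one_mul_eq_one hmodd (hpowm _) hcd1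
    have h2 : (2 : ℤ) ∣ p := by
      refine Int.dvd_of_eq_mul_isIntegral
        (z := k * ζ * (u * v) * (ζ ^ (-d) * z)) ?_ ?_
      · exact (((isIntegral_algebraMap (x := k)).mul hζint).mul (hu.mul hv)).mul
          ((hzint _).mul hz)
      · have e1 : ζ ^ c * ζ ^ (-d) = ζ ^ (c - d) := by rw [← zpow_add₀ hζ0, sub_eq_add_neg]
        have e2 : ζ ^ d * ζ ^ (-d) = 1 := by rw [← zpow_add₀ hζ0]; simp
        push_cast
        linear_combination (-(ζ ^ (-d) * z)) * hred - p * z * e1 - p * z * e2 - p * hz1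
    have : 2 ∣ p := by exact_mod_cast h2
    exact (Nat.not_even_iff_odd.mpr hodd) (even_iff_two_dvd.mpr this)
  have hsq : k * ζ * (ζ ^ c - 1) ^ 2 = p * (ζ - 1) ^ 2 * ζ ^ c := by
    rw [← hcd] at hmain
    linear_combination hmain / 2
  have hcinv : ζ ^ c * ζ ^ (-c) = 1 := by rw [← zpow_add₀ hζ0]; simp
  have hinv : ζ * ζ ^ (-1 : ℤ) = 1 := by rw [zpow_neg_one, mul_inv_cancel₀ hζ0]
  have hkp : k ∣ p := by
    refine Int.dvd_of_eq_mul_isIntegral (z := ζ * u ^ 2 * ζ ^ (-c))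
      ((hζint.mul (hu.pow 2)).mul (hzint _)) ?_
    refine mul_left_cancel₀ (pow_ne_zero 2 hζ1) ?_
    rw [hcu] at hsq
    push_cast
    linear_combination -(ζ ^ (-c)) * hsq - p * (ζ - 1) ^ 2 * hcinv
  have hpk : (p : ℤ) ∣ k := by
    obtain ⟨w, hw, hcw⟩ := exists_isIntegral_sub_one_eq_zpow_sub_one_mul hm0 hζm hcop
    refine Int.dvd_of_eq_mul_isIntegral (z := w ^ 2 * ζ ^ c * ζ ^ (-1 : ℤ))
      (((hw.pow 2).mul (hzint _)).mul (hzint _)) ?_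
    have hsq' : k * ζ = p * w ^ 2 * ζ ^ c := by
      refine mul_left_cancel₀ (pow_ne_zero 2 hcne) ?_
      linear_combination hsq + p * ζ ^ c * (ζ - 1 + (ζ ^ c - 1) * w) * hcw
    push_cast
    linear_combination ζ ^ (-1 : ℤ) * hsq' - k * hinv
  have hpC : (p : ℂ) ≠ 0 := by exact_mod_cast hp.ne_zero
  have hk : k = p := by
    rcases Int.natAbs_eq_natAbs_iff.mp (Int.natAbs_eq_of_dvd_dvd hkp hpk) with hk | hk
    · exact hk
    · refine absurd (Complex.eq_one_of_mul_sub_one_sq_add_eq_zero (z := ζ) (w := ζ ^ c)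
        (Complex.norm_eq_one_of_pow_eq_one hζm hm0.ne')
        (Complex.norm_eq_one_of_pow_eq_one (hpowm c) hm0.ne') ?_) (sub_ne_zero.mp hζ1)
      refine mul_left_cancel₀ hpC ?_
      rw [hk] at hsq
      push_cast at hsq
      linear_combination -hsq
  refine ⟨hk, ?_⟩
  have hfac : (ζ ^ c - ζ) * (ζ ^ c - ζ ^ (-1 : ℤ)) = 0 := by
    refine mul_left_cancel₀ (mul_ne_zero hpC hζ0) ?_
    rw [hk] at hsq
    push_cast at hsq
    linear_combination hsq - p * (ζ ^ c - ζ) * hinv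
  rcases mul_eq_zero.mp hfac with h1 | h1
  · have h2 : ζ ^ c = ζ ^ (1 : ℤ) := by rw [zpow_one]; exact sub_eq_zero.mp h1
    exact .inl ⟨(hprim.zpow_eq_zpow_iff_modEq hm0 _ _).mp h2,
      (hprim.zpow_eq_zpow_iff_modEq hm0 _ _).mp (hcd ▸ h2)⟩
  · have h2 := sub_eq_zero.mp h1
    exact .inr ⟨(hprim.zpow_eq_zpow_iff_modEq hm0 _ _).mp h2,
      (hprim.zpow_eq_zpow_iff_modEq hm0 _ _).mp (hcd ▸ h2)⟩
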